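/- Let k be a positive integer. Every even integer n > a_k(5,4) can be written as n = x^2 + y^2 + z^2 + 3w^2 with x, y, z, w nonnegative integers satisfying x + y + z + 3w = (2b)^k for some nonnegative integer b. -/

import Mathlib

noncomputable def aBound (k j l : ℕ) : ℝ :=
  (2 * k * l) ^ (2 * k) * (j + 1) ^ (2 * k - 1)

noncomputable def bBound (k j l : ℕ) : ℝ :=
  (1 / j) * Real.exp (2 * (k : ℝ) ^ ((3 : ℝ) / 2) * (j : ℝ) ^ ((1 : ℝ) / (4 * k)) *
    ((j : ℝ) + 1) ^ ((2 * (k : ℝ) - 1) / (4 * k)))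

noncomputable def cBound (k j l : ℕ) : ℝ :=
  max (aBound k j l) (max (bBound k j l) ((3275 : ℝ) ^ (2 * k) / j))

open scoped NumberTheorySymbols in
theorem exists_prime_and_dvd_sq_add (N : ℕ) (hN : N % 3 = 2) :
    ∃ (p : ℕ) (t : ℕ) (u : ℤ), p.Prime ∧ (p : ℤ) = 4 * N * (12 * t + 1) - 3 ∧
      (p : ℤ) ∣ u ^ 2 + (12 * t + 1) := by
  have hcop : IsCoprime (4 * N - 3 : ℤ) ((48 * N : ℕ) : ℤ) := by
    have h2 : IsCoprime (4 * N - 3 : ℤ) 2 := ⟨-1, 2 * N - 1, by ring⟩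
    have h3 : IsCoprime (4 * N - 3 : ℤ) 3 := by
      obtain ⟨m, hm⟩ : ∃ m : ℤ, (N : ℤ) = 3 * m + 2 := ⟨N / 3, by omega⟩
      exact ⟨-1, 4 * m + 2, by rw [hm]; ring⟩
    have hNN : IsCoprime (4 * N - 3 : ℤ) N := by
      have h : IsCoprime (3 : ℤ) N := by
        obtain ⟨m, hm⟩ : ∃ m : ℤ, (N : ℤ) = 3 * m + 2 := ⟨N / 3, by omega⟩
        exact ⟨m + 1, -1, by rw [hm]; ring⟩
      obtain ⟨a, b, hab⟩ := h
      exact ⟨-a, b + 4 * a, by linear_combination hab⟩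
    have e : ((48 * N : ℕ) : ℤ) = 2 ^ 4 * 3 * N := by push_cast; ring
    rw [e]
    exact ((h2.pow_right).mul_right h3).mul_right hNN
  obtain ⟨p, hpgt, hp, hmod⟩ :=
    Nat.forall_exists_prime_gt_and_zmodEq (4 * N) (q := 48 * N) (by omega) hcop
  obtain ⟨s, hs⟩ := hmod.symm.dvd
  have hs0 : 0 ≤ s := by
    by_contra! h
    have : (N : ℤ) * s ≤ 0 := mul_nonpos_of_nonneg_of_nonpos (by positivity) h.le
    push_cast at hs
    have : (4 * N : ℤ) < p := by exact_mod_cast hpgt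
    linarith
  lift s to ℕ using hs0
  have hpe : (p : ℤ) = 4 * N * (12 * s + 1) - 3 := by push_cast at hs; linarith
  refine ⟨p, s, ?_⟩
  have : Fact p.Prime := ⟨hp⟩
  have hp4 : p % 4 = 1 := by
    obtain ⟨q, hq⟩ : ∃ q : ℤ, (p : ℤ) = 4 * q - 3 := ⟨N * (12 * s + 1), by rw [hpe]; ring⟩
    omega
  have hJ : J(-((12 * s + 1 : ℕ) : ℤ) | p) = 1 := by
    have hpodd : Odd p := Nat.odd_iff.2 (by omega)
    have hsodd : Odd (12 * s + 1) := ⟨6 * s, by ring⟩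
    rw [jacobiSym.neg _ hpodd, ZMod.χ₄_nat_one_mod_four hp4, one_mul,
      ← jacobiSym.quadratic_reciprocity_one_mod_four hp4 hsodd,
      jacobiSym.mod_left' (a₂ := -3), jacobiSym.mod_right _ hsodd]
    · have : (12 * s + 1) % (4 * Int.natAbs (-3)) = 1 := by
        change (12 * s + 1) % 12 = 1
        omega
      rw [this, jacobiSym.one_right]
    · refine Int.ModEq.symm ((Int.modEq_iff_dvd).2 ⟨4 * N, ?_⟩)
      rw [hpe]; push_cast; ring
  obtain ⟨y, hy⟩ := ZMod.isSquare_of_jacobiSym_eq_one hJ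
  refine ⟨(y.val : ℤ), hp, hpe, ?_⟩
  rw [← ZMod.intCast_zmod_eq_zero_iff_dvd]
  push_cast at hy ⊢
  rw [ZMod.natCast_zmod_val]
  linear_combination -hy

theorem exists_translate_small (a d : ℤ) (ha : 0 < a) : ∃ k : ℤ, 4 * (a * k + d) ^ 2 ≤ a ^ 2 := by
  refine ⟨-((2 * d + a) / (2 * a)), ?_⟩
  have h1 := Int.mul_ediv_add_emod (2 * d + a) (2 * a)
  have h2 := Int.emod_nonneg (2 * d + a) (show 2 * a ≠ 0 by omega)
  have h3 := Int.emod_lt_of_pos (2 * d + a) (show 0 < 2 * a by omega)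
  generalize (2 * d + a) / (2 * a) = q at *
  generalize (2 * d + a) % (2 * a) = r at *
  have h4 : 2 * (a * -q + d) = r - a := by linarith
  nlinarith

/-- The ternary quadratic form with Gram matrix `!![a, d, e; d, b, f; e, f, c]`. -/
def ternaryForm (a b c d e f x y z : ℤ) : ℤ :=
  a * x ^ 2 + b * y ^ 2 + c * z ^ 2 + 2 * d * x * y + 2 * e * x * z + 2 * f * y * z

/-- A positive definite ternary form of determinant `3` that avoids the class `6` modulo `9` is
equivalent to `X ^ 2 + Y ^ 2 + 3 * Z ^ 2`; by reduction of the form and of its adjoint. -/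
theorem ternaryForm_eq_sq_add_sq_add_three_mul_sq (a b c d e f : ℤ) (ha : 0 < a)
    (hA : 0 < a * b - d ^ 2)
    (hdet : a * b * c + 2 * d * e * f - a * f ^ 2 - b * e ^ 2 - c * d ^ 2 = 3)
    (h9 : ∀ x y z, ternaryForm a b c d e f x y z % 9 ≠ 6) (x y z : ℤ) :
    ∃ X Y Z : ℤ, ternaryForm a b c d e f x y z = X ^ 2 + Y ^ 2 + 3 * Z ^ 2 := by
  obtain ⟨m, hm⟩ : ∃ m : ℕ, a + (a * b - d ^ 2) = m := ⟨_, (Int.toNat_of_nonneg (by omega)).symm⟩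
  induction m using Nat.strong_induction_on generalizing a b c d e f x y z with
  | _ m ih =>
    have hadj : (a * b - d ^ 2) * (a * c - e ^ 2) - (a * f - d * e) ^ 2 = 3 * a := by
      linear_combination a * hdet
    by_cases h1 : 4 * (a * b - d ^ 2) < 3 * a ^ 2
    · obtain ⟨k, hk⟩ := exists_translate_small a d ha
      have e1 : a * (a * k ^ 2 + 2 * d * k + b) = (a * k + d) ^ 2 + (a * b - d ^ 2) := by ring
      have hlt : a * k ^ 2 + 2 * d * k + b < a := by nlinarith
      have hpos : 0 < a * k ^ 2 + 2 * d * k + b := by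
        refine pos_of_mul_pos_right (a := a) ?_ ha.le
        rw [e1]; positivity
      have hA' : (a * k ^ 2 + 2 * d * k + b) * a - (-(a * k + d)) ^ 2 = a * b - d ^ 2 := by ring
      have hF : ∀ x y z, ternaryForm (a * k ^ 2 + 2 * d * k + b) a c (-(a * k + d)) (e * k + f)
          (-e) x y z = ternaryForm a b c d e f (k * x - y) x z := by
        intro x y z; simp only [ternaryForm]; ring
      obtain ⟨X, Y, Z, h⟩ := ih (a * k ^ 2 + 2 * d * k + b + (a * b - d ^ 2)).toNat (by omega)
        (a * k ^ 2 + 2 * d * k + b) a c (-(a * k + d)) (e * k + f) (-e) hpos (by omega)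
        (by linear_combination hdet) (fun x y z => by rw [hF]; exact h9 _ _ _) y (k * y - x) z
        (by omega)
      rw [hF] at h
      exact ⟨X, Y, Z, by rw [← h]; congr 1; ring⟩
    by_cases h2 : 4 * a < (a * b - d ^ 2) ^ 2
    · obtain ⟨k, hk⟩ := exists_translate_small _ (a * f - d * e) hA
      set A := a * b - d ^ 2 with hAdef
      have e1 : A * (A * k ^ 2 + 2 * (a * f - d * e) * k + (a * c - e ^ 2)) =
          (A * k + (a * f - d * e)) ^ 2 + 3 * a := by linear_combination hadj
      have hlt : A * k ^ 2 + 2 * (a * f - d * e) * k + (a * c - e ^ 2) < A := by nlinarith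
      have hpos : 0 < A * k ^ 2 + 2 * (a * f - d * e) * k + (a * c - e ^ 2) := by
        refine pos_of_mul_pos_right (a := A) ?_ hA.le
        rw [e1]; positivity
      have hA' : a * (b * k ^ 2 + 2 * f * k + c) - (d * k + e) ^ 2 =
          A * k ^ 2 + 2 * (a * f - d * e) * k + (a * c - e ^ 2) := by rw [hAdef]; ring
      have hF : ∀ x y z, ternaryForm a (b * k ^ 2 + 2 * f * k + c) b (d * k + e) (-d)
          (-(b * k + f)) x y z = ternaryForm a b c d e f x (k * y - z) y := by
        intro x y z; simp only [ternaryForm]; ring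
      obtain ⟨X, Y, Z, h⟩ := ih
        (a + (a * (b * k ^ 2 + 2 * f * k + c) - (d * k + e) ^ 2)).toNat (by omega)
        a (b * k ^ 2 + 2 * f * k + c) b (d * k + e) (-d) (-(b * k + f)) ha (by omega)
        (by linear_combination hdet) (fun x y z => by rw [hF]; exact h9 _ _ _) x z (k * z - y)
        (by omega)
      rw [hF] at h
      exact ⟨X, Y, Z, by rw [← h]; congr 1; ring⟩
    push Not at h1 h2
    have hA2 : a * b - d ^ 2 ≤ 2 := by
      by_contra! h
      have hle : 3 * (a * b - d ^ 2) ≤ 4 * a := by nlinarith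
      have : 9 * a ^ 2 ≤ 16 * a := by linarith
      nlinarith
    have ha1 : a = 1 := by nlinarith
    subst ha1
    obtain hA1 | hA1 : 1 * b - d ^ 2 = 1 ∨ 1 * b - d ^ 2 = 2 := by omega
    · obtain rfl : b = d ^ 2 + 1 := by linarith
      refine ⟨x + d * y + e * z, y + (f - d * e) * z, z, ?_⟩
      simp only [ternaryForm]
      linear_combination z ^ 2 * hadj
    · refine absurd ?_ (h9 (2 - d) 1 0)
      obtain rfl : b = d ^ 2 + 2 := by linarith
      have : ternaryForm 1 (d ^ 2 + 2) c d e f (2 - d) 1 0 = 6 := by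
        simp only [ternaryForm]; ring
      rw [this]; rfl

theorem three_dvd_of_three_dvd_sq_add_sq {x y : ℤ} (h : 3 ∣ x ^ 2 + y ^ 2) : 3 ∣ x ∧ 3 ∣ y := by
  have hx : x % 3 = 0 ∨ x % 3 = 1 ∨ x % 3 = 2 := by omega
  have hy : y % 3 = 0 ∨ y % 3 = 1 ∨ y % 3 = 2 := by omega
  have h' := Int.emod_eq_zero_of_dvd h
  rcases hx with hx | hx | hx <;> rcases hy with hy | hy | hy <;>
    first
    | exact ⟨Int.dvd_of_emod_eq_zero hx, Int.dvd_of_emod_eq_zero hy⟩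
    | simp [pow_two, Int.add_emod, Int.mul_emod, hx, hy] at h'

theorem exists_eq_sq_add_sq_add_three_mul_sq (N : ℕ) (hN : N % 3 = 2) :
    ∃ X Y Z : ℤ, (N : ℤ) = X ^ 2 + Y ^ 2 + 3 * Z ^ 2 := by
  obtain ⟨p, t, u, hp, hpe, v, hv⟩ := exists_prime_and_dvd_sq_add N hN
  have hp0 : (0 : ℤ) < p := by exact_mod_cast hp.pos
  have hv' : (4 * v) * p - (2 * u) ^ 2 = 4 * (12 * t + 1) := by linear_combination -4 * hv
  have hv0 : 0 < v := by
    refine pos_of_mul_pos_right (a := (p : ℤ)) ?_ hp0.le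
    rw [← hv]; positivity
  have key : ∀ x y z, ternaryForm (4 * v) p N (2 * u) 1 0 x y z % 9 ≠ 6 := by
    intro x y z h6
    obtain ⟨q, hq⟩ : ∃ q, ternaryForm (4 * v) p N (2 * u) 1 0 x y z = 9 * q + 6 :=
      ⟨ternaryForm (4 * v) p N (2 * u) 1 0 x y z / 9, by omega⟩
    obtain ⟨r, hr⟩ : ∃ r : ℤ, (p : ℤ) = 3 * r + 2 := by
      obtain ⟨m, hm⟩ : ∃ m : ℤ, (N : ℤ) = 3 * m + 2 := ⟨N / 3, by omega⟩
      exact ⟨4 * (m * (12 * t + 1)) + 32 * t + 1, by rw [hpe, hm]; ring⟩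
    set A := p * y + 2 * u * x with hAdef
    set B := 4 * (12 * t + 1) * x + p * z with hBdef
    have hid : 4 * (12 * (t : ℤ) + 1) * p * (9 * q + 6) =
        4 * (12 * t + 1) * A ^ 2 + B ^ 2 + 3 * p * z ^ 2 := by
      rw [← hq, hAdef, hBdef]; simp only [ternaryForm]
      linear_combination (4 * (12 * (t : ℤ) + 1) * x ^ 2) * hv' - p * z ^ 2 * hpe
    have hAB : (3 : ℤ) ∣ A ^ 2 + B ^ 2 :=
      ⟨4 * (12 * (t : ℤ) + 1) * p * (3 * q + 2) - p * z ^ 2 - (16 * t + 1) * A ^ 2, by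
        linear_combination -hid⟩
    obtain ⟨⟨A', hA'⟩, ⟨B', hB'⟩⟩ := three_dvd_of_three_dvd_sq_add_sq hAB
    rw [hA', hB', hr] at hid
    have hz : (2 * z ^ 2 - 1) % 3 = 0 := by
      obtain ⟨w, hw⟩ : ∃ w, 2 * z ^ 2 - 1 = 3 * w := by
        refine ⟨4 * (12 * (t : ℤ) + 1) * ((3 * r + 2) * q + 2 * r) + 64 * t + 5
          - 4 * (12 * (t : ℤ) + 1) * A' ^ 2 - B' ^ 2 - r * z ^ 2, ?_⟩
        linarith
      omega
    have hz3 : z % 3 = 0 ∨ z % 3 = 1 ∨ z % 3 = 2 := by omega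
    rcases hz3 with h | h | h <;> simp [pow_two, Int.sub_emod, Int.mul_emod, h] at hz
  obtain ⟨X, Y, Z, h⟩ := ternaryForm_eq_sq_add_sq_add_three_mul_sq (4 * v) p N (2 * u) 1 0
    (by omega) (by rw [hv']; positivity) (by linear_combination N * hv' - hpe) key 0 0 1
  exact ⟨X, Y, Z, by rw [← h]; simp [ternaryForm]⟩

theorem exists_sign_modEq_three {X m : ℤ} (hX : ¬ 3 ∣ X) (hm : ¬ 3 ∣ m) :
    ∃ X' : ℤ, X' ^ 2 = X ^ 2 ∧ 3 ∣ m - X' := by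
  by_cases h : 3 ∣ m - X
  · exact ⟨X, rfl, h⟩
  · have hX' : X % 3 = 1 ∨ X % 3 = 2 := by omega
    have hm' : m % 3 = 1 ∨ m % 3 = 2 := by omega
    exact ⟨-X, by ring, by omega⟩

/-- Cauchy's lemma for the form `x ^ 2 + y ^ 2 + z ^ 2 + 3 * w ^ 2`. -/
theorem exists_nat_rep_of_sum_eq {n m : ℕ} (hm : ¬ 3 ∣ m) (h5 : 5 * (2 * n) ≤ (2 * m) ^ 2)
    (h6 : (2 * m) ^ 2 ≤ 6 * (2 * n)) :
    ∃ x y z w : ℕ, 2 * n = x ^ 2 + y ^ 2 + z ^ 2 + 3 * w ^ 2 ∧ x + y + z + 3 * w = 2 * m := by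
  obtain ⟨N, hN⟩ : ∃ N, 3 * n = m ^ 2 + N := ⟨3 * n - m ^ 2, by
    have : m ^ 2 ≤ 3 * n := by nlinarith
    omega⟩
  have hm3 : m ^ 2 % 3 = 1 := by
    have : m % 3 = 1 ∨ m % 3 = 2 := by omega
    rcases this with h | h <;> simp [Nat.pow_mod, h]
  obtain ⟨X₀, Y₀, Z, hXYZ⟩ := exists_eq_sq_add_sq_add_three_mul_sq N (by omega)
  have hnot : ¬ (3 : ℤ) ∣ X₀ ∧ ¬ (3 : ℤ) ∣ Y₀ := by
    have h2 : (X₀ ^ 2 + Y₀ ^ 2) % 3 = 2 := by omega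
    have hx : X₀ % 3 = 0 ∨ X₀ % 3 = 1 ∨ X₀ % 3 = 2 := by omega
    have hy : Y₀ % 3 = 0 ∨ Y₀ % 3 = 1 ∨ Y₀ % 3 = 2 := by omega
    rcases hx with hx | hx | hx <;> rcases hy with hy | hy | hy <;>
      simp [pow_two, Int.add_emod, Int.mul_emod, hx, hy] at h2 <;> omega
  have hmZ : ¬ (3 : ℤ) ∣ m := by omega
  obtain ⟨X, hX, hX3⟩ := exists_sign_modEq_three hnot.1 hmZ
  obtain ⟨Y, hY, v, hv⟩ := exists_sign_modEq_three hnot.2 hmZ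
  obtain ⟨s, hs⟩ : (3 : ℤ) ∣ X - Y := by omega
  obtain rfl : X = Y + 3 * s := by omega
  have hmv : (m : ℤ) = Y + 3 * v := by omega
  have hNZ : (3 : ℤ) * n = m ^ 2 + ((Y + 3 * s) ^ 2 + Y ^ 2 + 3 * Z ^ 2) := by
    rw [hX, hY, ← hXYZ]; exact_mod_cast hN
  have hsq : ∀ x y z w : ℤ, 2 * (n : ℤ) = x ^ 2 + y ^ 2 + z ^ 2 + 3 * w ^ 2 →
      x + y + z + 3 * w = 2 * m → 0 ≤ x := by
    intro x y z w h1 h2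
    by_contra! hx
    have h5' : 5 * (2 * (n : ℤ)) ≤ (2 * m) ^ 2 := by exact_mod_cast h5
    have h3 : (2 * (m : ℤ)) < y + z + 3 * w := by omega
    have h4 : (0 : ℤ) ≤ m := by positivity
    nlinarith [sq_nonneg (y - z), sq_nonneg (y - w), sq_nonneg (z - w), sq_pos_of_neg hx]
  have hsqw : ∀ x y z w : ℤ, 2 * (n : ℤ) = x ^ 2 + y ^ 2 + z ^ 2 + 3 * w ^ 2 →
      x + y + z + 3 * w = 2 * m → 0 ≤ w := by
    intro x y z w h1 h2
    by_contra! hw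
    have h5' : 5 * (2 * (n : ℤ)) ≤ (2 * m) ^ 2 := by exact_mod_cast h5
    have h3 : (2 * (m : ℤ)) < x + y + z := by omega
    have h4 : (0 : ℤ) ≤ m := by positivity
    nlinarith [sq_nonneg (x - y), sq_nonneg (y - z), sq_nonneg (x - z), sq_pos_of_neg hw]
  obtain ⟨x, y, z, w, h1, h2⟩ : ∃ x y z w : ℤ,
      2 * (n : ℤ) = x ^ 2 + y ^ 2 + z ^ 2 + 3 * w ^ 2 ∧ x + y + z + 3 * w = 2 * m := by
    refine ⟨v + Y + s - Z, v + Y + s + Z, v + s, v - s, ?_, by rw [hmv]; ring⟩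
    rw [hmv] at hNZ
    have : 3 * (2 * (n : ℤ)) = 3 * ((v + Y + s - Z) ^ 2 + (v + Y + s + Z) ^ 2 + (v + s) ^ 2 +
        3 * (v - s) ^ 2) := by linear_combination 2 * hNZ
    linarith
  have hx := hsq x y z w h1 h2
  have hy := hsq y x z w (by linarith) (by linarith)
  have hz := hsq z y x w (by linarith) (by linarith)
  have hw := hsqw x y z w h1 h2
  lift x to ℕ using hx
  lift y to ℕ using hy
  lift z to ℕ using hz
  lift w to ℕ using hw
  exact ⟨x, y, z, w, by exact_mod_cast h1, by exact_mod_cast h2⟩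

theorem five_mul_pow_le_six_mul_sub_pow {K u : ℕ} (hu : 24 * K ≤ u) (h4 : 4 ≤ u) :
    5 * (u : ℝ) ^ K ≤ 6 * ((u : ℝ) - 4) ^ K := by
  have hu0 : (0 : ℝ) < u := by exact_mod_cast (by omega : 0 < u)
  have h4' : (4 : ℝ) ≤ u := by exact_mod_cast h4
  have huK : (24 * K : ℝ) ≤ u := by exact_mod_cast hu
  have hB := one_add_mul_le_pow (a := -(4 / (u : ℝ)))
    (by rw [neg_le_neg_iff, div_le_iff₀ hu0]; linarith) K
  have h56 : (5 / 6 : ℝ) ≤ (1 + -(4 / (u : ℝ))) ^ K := by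
    refine le_trans ?_ hB
    have : (K : ℝ) * (4 / u) ≤ 1 / 6 := by
      rw [← mul_div_assoc, div_le_iff₀ hu0]; linarith
    linarith
  have e : ((u : ℝ) - 4) ^ K = (1 + -(4 / (u : ℝ))) ^ K * u ^ K := by
    rw [← mul_pow]; congr 1; field_simp; ring
  rw [e]
  nlinarith [pow_pos hu0 K]

theorem exists_even_pow_between {k n : ℕ} (hk : 0 < k) (hn : (48 * k) ^ (2 * k) < 6 * n) :
    ∃ b : ℕ, ¬ 3 ∣ b ∧ 5 * n ≤ ((2 * b) ^ k) ^ 2 ∧ ((2 * b) ^ k) ^ 2 ≤ 6 * n := by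
  have hex : ∃ c : ℕ, 6 * n < (2 * (c + 1)) ^ (2 * k) :=
    ⟨6 * n, lt_of_lt_of_le (by omega) (Nat.le_self_pow (by omega) _)⟩
  obtain ⟨c, hc, hmin⟩ : ∃ c : ℕ, 6 * n < (2 * (c + 1)) ^ (2 * k) ∧
      ∀ c' < c, (2 * (c' + 1)) ^ (2 * k) ≤ 6 * n := by
    classical
    exact ⟨Nat.find hex, Nat.find_spec hex, fun c' h => not_lt.1 (Nat.find_min hex h)⟩
  have hu : 48 * k < 2 * (c + 1) := lt_of_pow_lt_pow_left₀ (2 * k) (by omega) (hn.trans hc)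
  have hlow : 5 * n ≤ (2 * (c - 1)) ^ (2 * k) := by
    have h := five_mul_pow_le_six_mul_sub_pow (K := 2 * k) (u := 2 * (c + 1)) (by omega) (by omega)
    have e : ((2 * (c + 1) : ℕ) : ℝ) - 4 = ((2 * (c - 1) : ℕ) : ℝ) := by
      rw [show 2 * (c + 1) = 2 * (c - 1) + 4 by omega]; push_cast; ring
    rw [e] at h
    have h' : 5 * (2 * (c + 1)) ^ (2 * k) ≤ 6 * (2 * (c - 1)) ^ (2 * k) := by exact_mod_cast h
    omega
  have hc0 : (2 * c) ^ (2 * k) ≤ 6 * n := by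
    have := hmin (c - 1) (by omega)
    rwa [show c - 1 + 1 = c by omega] at this
  have hle : (2 * (c - 1)) ^ (2 * k) ≤ (2 * c) ^ (2 * k) := Nat.pow_le_pow_left (by omega) _
  have hpow : ∀ b : ℕ, ((2 * b) ^ k) ^ 2 = (2 * b) ^ (2 * k) := fun b => by
    rw [← pow_mul, mul_comm k 2]
  by_cases h3 : 3 ∣ c
  · exact ⟨c - 1, by omega, by rwa [hpow], by rw [hpow]; omega⟩
  · exact ⟨c, h3, by rw [hpow]; omega, by rwa [hpow]⟩

theorem form_1113_sum_even_power (k : ℕ) (hk : 0 < k) (n : ℕ)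
    (heven : Even n) (hn : (n : ℝ) > aBound k 5 4) :
    ∃ x y z w b : ℕ,
      n = x ^ 2 + y ^ 2 + z ^ 2 + 3 * w ^ 2 ∧ x + y + z + 3 * w = (2 * b) ^ k := by
  obtain ⟨n', rfl⟩ := heven.exists_two_nsmul
  obtain ⟨j, rfl⟩ : ∃ j, k = j + 1 := ⟨k - 1, by omega⟩
  rw [smul_eq_mul] at *
  have hbound : (48 * (j + 1)) ^ (2 * (j + 1)) < 6 * (2 * n') := by
    have h : ((48 * (j + 1) : ℕ) : ℝ) ^ (2 * (j + 1)) = 6 * aBound (j + 1) 5 4 := by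
      rw [aBound, show 2 * (j + 1) - 1 = 2 * j + 1 by omega,
        show ((48 * (j + 1) : ℕ) : ℝ) = (2 * ((j + 1 : ℕ) : ℝ) * (4 : ℕ)) * 6 by push_cast; ring,
        mul_pow, show 2 * (j + 1) = 2 * j + 1 + 1 by ring, pow_succ (6 : ℝ)]
      norm_num
      ring
    have : ((48 * (j + 1) : ℕ) : ℝ) ^ (2 * (j + 1)) < 6 * ((2 * n' : ℕ) : ℝ) := by
      rw [h]; linarith
    exact_mod_cast this
  obtain ⟨b, hb3, h5, h6⟩ := exists_even_pow_between hk hbound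
  have hm : (2 * b) ^ (j + 1) = 2 * (2 ^ j * b ^ (j + 1)) := by rw [mul_pow, pow_succ 2]; ring
  have hm3 : ¬ 3 ∣ 2 ^ j * b ^ (j + 1) := by
    intro h
    rcases (Nat.prime_three.dvd_mul).1 h with h | h
    · have := Nat.prime_three.dvd_of_dvd_pow h
      omega
    · exact hb3 (Nat.prime_three.dvd_of_dvd_pow h)
  rw [hm] at h5 h6
  obtain ⟨x, y, z, w, h1, h2⟩ := exists_nat_rep_of_sum_eq hm3 h5 h6
  exact ⟨x, y, z, w, b, h1, by rw [hm]; exact h2⟩
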